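/- Let A be a commutative ring and n ≥ 1, and let ε_J, ε*_J ∈ A be two families indexed by the intervals of {1,…,n} (with the conventions ε_∅ = ε*_∅ = 1). If Σ_{j=s−1}^{t} (−1)^{j−s+1} ε_{[s,j]} ε*_{[j+1,t]} = 0 holds for all 1 ≤ s ≤ t ≤ n, then ε*_J = Σ_{P partition of J} (−1)^{|J|−l(P)} ε_P for every interval J; in particular ε*_{[i,i]} = ε_{[i,i]} for all i. -/

import Mathlib

open Finset

namespace EpsSys

/-- All partitions of the interval `[s,t]` into consecutive blocks `(a,b)` (meaning `{a,…,b}`),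
listed left to right; the first argument is fuel. For the empty interval (`t < s`) the only
partition is the empty list. -/
def partitionsAux : ℕ → ℕ → ℕ → List (List (ℕ × ℕ))
  | 0, _, _ => [[]]
  | fuel+1, s, t =>
    if t < s then [[]]
    else (List.range (t + 1 - s)).flatMap fun d =>
      (partitionsAux fuel (s + d + 1) t).map (fun P => (s, s + d) :: P)

/-- The list of all partitions of the interval `[s,t]`. -/
def partitions (s t : ℕ) : List (List (ℕ × ℕ)) :=
  partitionsAux (t + 1 - s) s t

variable {A : Type*} [CommRing A]

/-- `ε_P`: the product of `ε` over the blocks of a partition `P`. -/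
def epsP (eps : ℕ → ℕ → A) (P : List (ℕ × ℕ)) : A :=
  (P.map fun p => eps p.1 p.2).prod

/-- The partition sum `ε*_{[s,t]} = Σ_{P partition of [s,t]} (−1)^{|J| − l(P)} ε_P`.
For the empty interval (`t < s`) this equals `1`. -/
def epsStar (eps : ℕ → ℕ → A) (s t : ℕ) : A :=
  ((partitions s t).map fun P => (-1 : A) ^ (t + 1 - s - P.length) * epsP eps P).sum

/-- Extension of a family indexed by intervals by the convention `ε_∅ = 1`. -/
def epsE (eps : ℕ → ℕ → A) (s t : ℕ) : A :=
  if t < s then 1 else eps s t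

end EpsSys


namespace EpsSys

theorem partitionsAux_eq_of_le (f g s t : ℕ) (hf : t + 1 - s ≤ f) (hg : t + 1 - s ≤ g) :
    partitionsAux f s t = partitionsAux g s t := by
  induction f generalizing g s with
  | zero =>
    cases g with
    | zero => rfl
    | succ g => rw [partitionsAux, partitionsAux, if_pos (by omega)]
  | succ f ih =>
    cases g with
    | zero => rw [partitionsAux, partitionsAux, if_pos (by omega)]
    | succ g =>
      rw [partitionsAux, partitionsAux]
      split_ifs with h
      · rfl
      · refine List.flatMap_congr fun d _ => ?_
        rw [ih g (s + d + 1) (by omega) (by omega)]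

theorem partitions_of_lt {s t : ℕ} (h : t < s) : partitions s t = [[]] := by
  rw [partitions, show t + 1 - s = 0 by omega, partitionsAux]

theorem partitions_of_le {s t : ℕ} (h : s ≤ t) :
    partitions s t = (List.range (t + 1 - s)).flatMap fun d =>
      (partitions (s + d + 1) t).map fun P => (s, s + d) :: P := by
  rw [partitions, partitionsAux_eq_of_le (t + 1 - s) (t - s + 1) s t (by omega) (by omega),
    partitionsAux, if_neg (by omega)]
  refine List.flatMap_congr fun d _ => ?_
  rw [partitions, partitionsAux_eq_of_le (t - s) (t + 1 - (s + d + 1)) _ t (by omega) (by omega)]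

theorem length_le_of_mem_partitionsAux (f s t : ℕ) {P : List (ℕ × ℕ)}
    (hP : P ∈ partitionsAux f s t) : P.length ≤ t + 1 - s := by
  induction f generalizing s P with
  | zero => simp_all [partitionsAux]
  | succ f ih =>
    rw [partitionsAux] at hP
    split_ifs at hP with h
    · simp_all
    · simp only [List.mem_flatMap, List.mem_range, List.mem_map] at hP
      obtain ⟨d, hd, Q, hQ, rfl⟩ := hP
      have := ih _ hQ
      rw [List.length_cons]
      omega

theorem epsStar_of_lt {A : Type*} [CommRing A] (eps : ℕ → ℕ → A) {s t : ℕ} (h : t < s) :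
    epsStar eps s t = 1 := by
  simp [epsStar, partitions_of_lt h, epsP, show t + 1 - s = 0 by omega]

/-- Splitting off the first block of each partition. -/
theorem epsStar_of_le {A : Type*} [CommRing A] (eps : ℕ → ℕ → A) {s t : ℕ} (h : s ≤ t) :
    epsStar eps s t = ∑ d ∈ Finset.range (t + 1 - s),
      (-1) ^ d * eps s (s + d) * epsStar eps (s + d + 1) t := by
  rw [epsStar, partitions_of_le h, List.map_flatMap, List.flatMap_def, List.sum_flatten,
    List.map_map]
  change ∑ d ∈ Finset.range (t + 1 - s), _ = _
  refine Finset.sum_congr rfl fun d hd => ?_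
  rw [Finset.mem_range] at hd
  rw [Function.comp_apply, List.map_map, epsStar, ← List.sum_map_mul_left]
  refine congrArg List.sum (List.map_congr_left fun P hP => ?_)
  have hl := length_le_of_mem_partitionsAux _ _ _ hP
  have he : t + 1 - s - (P.length + 1) = d + (t + 1 - (s + d + 1) - P.length) := by omega
  simp only [Function.comp_apply, List.length_cons, he, epsP, List.map_cons, List.prod_cons,
    pow_add]
  ring

end EpsSys

open EpsSys

/-- if two families `ε_J`, `ε*_J` (with the convention `ε_∅ = ε*_∅ = 1`,
implemented by `epsE`) satisfy `Σ_{j=s−1}^{t} (−1)^{j−s+1} ε_{[s,j]} ε*_{[j+1,t]} = 0`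
for all `1 ≤ s ≤ t ≤ n`, then `ε*_J` is given by the partition sum
`Σ_{P partition of J} (−1)^{|J|−l(P)} ε_P` for every interval `J`; in particular
`ε*_{[i,i]} = ε_{[i,i]}` for all `i`. -/
theorem stmt1 {A : Type*} [CommRing A] (n : ℕ) (hn : 1 ≤ n)
    (eps epsstar : ℕ → ℕ → A)
    (hrel : ∀ s t : ℕ, 1 ≤ s → s ≤ t → t ≤ n →
      (∑ j ∈ Finset.Icc (s - 1) t,
        (-1 : A) ^ (j + 1 - s) * epsE eps s j * epsE epsstar (j + 1) t) = 0) :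
    (∀ s t : ℕ, 1 ≤ s → s ≤ t → t ≤ n → epsstar s t = epsStar eps s t) ∧
    (∀ i : ℕ, 1 ≤ i → i ≤ n → epsstar i i = eps i i) := by
  have key : ∀ s t : ℕ, 1 ≤ s → s ≤ t → t ≤ n → epsstar s t = epsStar eps s t := by
    intro s t hs hst htn
    induction hk : t - s using Nat.strong_induction_on generalizing s with
    | _ k ih =>
      have h := hrel s t hs hst htn
      rw [← Finset.Ico_add_one_right_eq_Icc, Finset.sum_Ico_eq_sum_range,
        show t + 1 - (s - 1) = t + 1 - s + 1 by omega, Finset.sum_range_succ'] at h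
      have h0 : epsE epsstar (s - 1 + 0 + 1) t = epsstar s t := by
        rw [show s - 1 + 0 + 1 = s by omega, epsE, if_neg (by omega)]
      have h1 : epsE eps s (s - 1 + 0) = 1 := if_pos (by omega)
      rw [h0, h1, show s - 1 + 0 + 1 - s = 0 by omega, pow_zero, one_mul, one_mul, add_comm] at h
      rw [eq_neg_of_add_eq_zero_left h, epsStar_of_le eps hst, ← Finset.sum_neg_distrib]
      refine Finset.sum_congr rfl fun d hd => ?_
      rw [Finset.mem_range] at hd
      have h2 : epsE epsstar (s + d + 1) t = epsStar eps (s + d + 1) t := by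
        rw [epsE]
        split_ifs with hlt
        · exact (epsStar_of_lt eps hlt).symm
        · exact ih (t - (s + d + 1)) (by omega) (s + d + 1) (by omega) (by omega) rfl
      rw [show s - 1 + (d + 1) = s + d by omega, show s + d + 1 - s = d + 1 by omega, h2,
        epsE, if_neg (by omega), pow_succ]
      ring
  refine ⟨key, fun i hi hin => ?_⟩
  rw [key i i hi le_rfl hin, epsStar_of_le eps le_rfl]
  simp [epsStar_of_lt]
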